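/- Let t ≥ 1 be an integer, let w_M, w_N ∈ ℤ, and let p_1 < p_2 < ⋯ < p_{t+1} and a_1 < a_2 < ⋯ < a_t be strictly increasing integer sequences. Define the conjugate sequences p̄_i := w_M − p_{t+2−i} (1 ≤ i ≤ t+1) and ā_j := w_N − a_{t+1−j} (1 ≤ j ≤ t). Assume there exists Q ∈ ℤ such that for every P ∈ {p, p̄}, every A ∈ {a, ā}, and every 1 ≤ i ≤ t one has −P_{t+2−i} < A_i + Q ≤ −P_{t+1−i} (the strong interlace condition with shift Q). Set q★ := min{P_{t+2−i} + A_i : 1 ≤ i ≤ t, P ∈ {p, p̄}, A ∈ {a, ā}}, and let H be the multiset of integers {P_i + A_j : 1 ≤ i ≤ t+1, 1 ≤ j ≤ t, P ∈ {p, p̄}, A ∈ {a, ā}}, each quadruple (P, A, i, j) contributing exactly one element, so that H has 4t(t+1) elements counted with multiplicity. Then the number of elements of H (with multiplicity) that are strictly less than q★ equals the number of elements of H that are ≥ q★, and both numbers equal 2t(t+1). -/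

import Mathlib

open Finset in
/-- Complex-place case of the combinatorial lemma on Hodge types (Lemma 4.6). -/
theorem stmt_1 (t : ℕ) (ht : 1 ≤ t) (wM wN : ℤ) (p a pbar abar : ℕ → ℤ)
    (hp : ∀ i j, 1 ≤ i → i < j → j ≤ t + 1 → p i < p j)
    (ha : ∀ i j, 1 ≤ i → i < j → j ≤ t → a i < a j)
    (hpbar : ∀ i, 1 ≤ i → i ≤ t + 1 → pbar i = wM - p (t + 2 - i))
    (habar : ∀ j, 1 ≤ j → j ≤ t → abar j = wN - a (t + 1 - j))
    (hQ : ∃ Q : ℤ, ∀ P ∈ ({p, pbar} : Set (ℕ → ℤ)), ∀ A ∈ ({a, abar} : Set (ℕ → ℤ)),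
      ∀ i, 1 ≤ i → i ≤ t → -P (t + 2 - i) < A i + Q ∧ A i + Q ≤ -P (t + 1 - i))
    (qstar : ℤ)
    (hqstar : IsLeast {v : ℤ | ∃ P ∈ ({p, pbar} : Set (ℕ → ℤ)),
      ∃ A ∈ ({a, abar} : Set (ℕ → ℤ)),
      ∃ i, 1 ≤ i ∧ i ≤ t ∧ v = P (t + 2 - i) + A i} qstar) :
    (((univ : Finset Bool) ×ˢ (univ : Finset Bool) ×ˢ Icc 1 (t + 1) ×ˢ Icc 1 t).filter
        (fun x => (if x.1 then pbar else p) x.2.2.1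
          + (if x.2.1 then abar else a) x.2.2.2 < qstar)).card
      = (((univ : Finset Bool) ×ˢ (univ : Finset Bool) ×ˢ Icc 1 (t + 1) ×ˢ Icc 1 t).filter
        (fun x => qstar ≤ (if x.1 then pbar else p) x.2.2.1
          + (if x.2.1 then abar else a) x.2.2.2)).card ∧
    (((univ : Finset Bool) ×ˢ (univ : Finset Bool) ×ˢ Icc 1 (t + 1) ×ˢ Icc 1 t).filter
        (fun x => (if x.1 then pbar else p) x.2.2.1
          + (if x.2.1 then abar else a) x.2.2.2 < qstar)).card
      = 2 * (t * (t + 1)) ∧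
    (((univ : Finset Bool) ×ˢ (univ : Finset Bool) ×ˢ Icc 1 (t + 1) ×ˢ Icc 1 t).filter
        (fun x => qstar ≤ (if x.1 then pbar else p) x.2.2.1
          + (if x.2.1 then abar else a) x.2.2.2)).card
      = 2 * (t * (t + 1)) := by
  classical
  obtain ⟨Q, hQ⟩ := hQ
  obtain ⟨⟨P0, hP0, A0, hA0, i0, hi0, hi0', hq0⟩, hlb⟩ := hqstar
  have hQq : -Q < qstar := by
    have := (hQ P0 hP0 A0 hA0 i0 hi0 hi0').1
    omega
  have hmono : ∀ P ∈ ({p, pbar} : Set (ℕ → ℤ)), ∀ i j, 1 ≤ i → i ≤ j → j ≤ t + 1 → P i ≤ P j := by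
    intro P hP i j hi hij hj
    rcases hij.eq_or_lt with h | h
    · rw [h]
    rcases hP with rfl | rfl
    · exact (hp i j hi h hj).le
    · rw [hpbar i hi (by omega), hpbar j (by omega) hj]
      have := hp (t + 2 - j) (t + 2 - i) (by omega) (by omega) (by omega)
      omega
  have key : ∀ P ∈ ({p, pbar} : Set (ℕ → ℤ)), ∀ A ∈ ({a, abar} : Set (ℕ → ℤ)),
      ∀ i j, 1 ≤ i → i ≤ t + 1 → 1 ≤ j → j ≤ t → (P i + A j < qstar ↔ i + j ≤ t + 1) := by
    intro P hP A hA i j hi hi' hj hj'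
    constructor
    · intro h
      by_contra hc
      have h1 := hmono P hP (t + 2 - j) i (by omega) (by omega) hi'
      have h2 : qstar ≤ P (t + 2 - j) + A j := hlb ⟨P, hP, A, hA, j, hj, hj', rfl⟩
      omega
    · intro h
      have h1 := hmono P hP i (t + 1 - j) hi (by omega) (by omega)
      have h2 := (hQ P hP A hA j hj hj').2
      omega
  set S := (univ : Finset Bool) ×ˢ (univ : Finset Bool) ×ˢ Icc 1 (t + 1) ×ˢ Icc 1 t with hS
  have hkey : ∀ x ∈ S, ((if x.1 then pbar else p) x.2.2.1
          + (if x.2.1 then abar else a) x.2.2.2 < qstar ↔ x.2.2.1 + x.2.2.2 ≤ t + 1) := by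
    rintro ⟨b, c, i, j⟩ hx
    simp only [hS, mem_product, mem_univ, mem_Icc, true_and] at hx
    apply key _ _ _ _ i j hx.1.1 hx.1.2 hx.2.1 hx.2.2
    · cases b <;> simp
    · cases c <;> simp
  have hcardS : S.card = 4 * (t * (t + 1)) := by
    simp only [hS, card_product, card_univ, Fintype.card_bool, Nat.card_Icc, Nat.add_sub_cancel]
    ring
  have e1 := filter_congr hkey
  have e2 : S.filter (fun x => qstar ≤ (if x.1 then pbar else p) x.2.2.1
          + (if x.2.1 then abar else a) x.2.2.2)
        = S.filter (fun x => ¬ (x.2.2.1 + x.2.2.2 ≤ t + 1)) := by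
    apply filter_congr
    intro x hx
    rw [← hkey x hx, not_lt]
  have hsum := card_filter_add_card_filter_not (s := S) (fun x => x.2.2.1 + x.2.2.2 ≤ t + 1)
  have heq : (S.filter (fun x => x.2.2.1 + x.2.2.2 ≤ t + 1)).card
      = (S.filter (fun x => ¬ (x.2.2.1 + x.2.2.2 ≤ t + 1))).card := by
    apply card_nbij' (fun x => (x.1, x.2.1, t + 2 - x.2.2.1, t + 1 - x.2.2.2))
      (fun x => (x.1, x.2.1, t + 2 - x.2.2.1, t + 1 - x.2.2.2))
    all_goals
      rintro ⟨b, c, i, j⟩ hx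
      simp only [hS, coe_filter, Set.mem_setOf_eq, mem_filter, mem_product, mem_univ, mem_Icc, true_and, Prod.mk.injEq] at hx ⊢
      omega
  rw [e1, e2]
  omega
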